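/- arXiv:1301.4685 — 2 statements merged into one kernel-verified Lean document; each statement's English description precedes it below -/
import Mathlib

section
/- Let (A,‖·‖) be a commutative complex Banach algebra which is semisimple (its Jacobson radical is {0}) and regular. Then every algebra norm p on A (every submultiplicative norm, not assumed complete nor comparable with ‖·‖) makes (A,p) a Q-algebra, i.e., the set of quasi-invertible elements of A is open in the topology of p. -/
/-- `x` is quasi-invertible: there is `y` with `x ∘ y = y ∘ x = 0`
where `x ∘ y = x + y - x*y`. -/
def IsQuasiInv {A : Type*} [NonUnitalRing A] (x : A) : Prop :=
  ∃ y, x + y - x * y = 0 ∧ y + x - y * x = 0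

/-- `S` is open in the topology induced by the norm `p`. -/
def NormOpen {A : Type*} [AddGroup A] (p : A → ℝ) (S : Set A) : Prop :=
  ∀ x ∈ S, ∃ ε > 0, ∀ y, p (y - x) < ε → y ∈ S

/-- `M(A)`: the nonzero continuous multiplicative linear functionals on the
topological algebra `A`. -/
def CharSpace (A : Type*) [NonUnitalRing A] [Module ℂ A] [TopologicalSpace A] :
    Set (A → ℂ) :=
  {f | (∀ x y, f (x + y) = f x + f y) ∧ (∀ (c : ℂ) (x : A), f (c • x) = c * f x) ∧
       (∀ x y, f (x * y) = f x * f y) ∧ f ≠ 0 ∧ Continuous f}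

/-- `A` is regular: for every subset `F` of `M(A)` closed in the weak-*
(pointwise convergence) topology and every `f₁ ∈ M(A) \ F` there is `x ∈ A`
vanishing on `F` with `f₁ x ≠ 0`. -/
def IsRegularAlg (A : Type*) [NonUnitalRing A] [Module ℂ A] [TopologicalSpace A] : Prop :=
  ∀ F : Set (A → ℂ), F ⊆ CharSpace A →
    IsClosed {g : ↥(CharSpace A) | (g : A → ℂ) ∈ F} →
    ∀ f₁ ∈ CharSpace A, f₁ ∉ F → ∃ x : A, (∀ f ∈ F, f x = 0) ∧ f₁ x ≠ 0

section AlgNormAux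

open Metric

abbrev UL (A : Type*) [NonUnitalNormedCommRing A] [NormedSpace ℂ A] := WithLp 1 (Unitization ℂ A)

noncomputable instance instULNormedCommRing {A : Type*} [NonUnitalNormedCommRing A]
    [NormedSpace ℂ A] [SMulCommClass ℂ A A] [IsScalarTower ℂ A A] : NormedCommRing (UL A) :=
  { WithLp.instUnitizationNormedRing with
    mul_comm := fun x y => by
      apply (WithLp.equiv 1 (Unitization ℂ A)).injective
      exact mul_comm (WithLp.ofLp x) (WithLp.ofLp y) }

theorem exists_char_of_not_isUnit {D : Type*} [NormedCommRing D] [NormedAlgebra ℂ D]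
    [CompleteSpace D] {a : D} (ha : ¬ IsUnit a) : ∃ φ : D →ₐ[ℂ] ℂ, φ a = 0 := by
  obtain ⟨f, hf⟩ := WeakDual.CharacterSpace.exists_apply_eq_zero ha
  exact ⟨WeakDual.CharacterSpace.equivAlgHom f, hf⟩

theorem alg_hom_cont {D : Type*} [NormedCommRing D] [NormedAlgebra ℂ D]
    [CompleteSpace D] (φ : D →ₐ[ℂ] ℂ) : Continuous φ :=
  AddMonoidHomClass.continuous_of_bound φ ‖(1 : D)‖ fun a => by
    rw [mul_comm]; exact AlgHom.norm_apply_le_self_mul_norm_one φ a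

theorem exists_local_inverse {D : Type*} [NormedCommRing D] [NormedAlgebra ℂ D]
    [CompleteSpace D] (z : D) (hz : ∀ φ : D →ₐ[ℂ] ℂ, φ z = 0 ∨ 1 ≤ ‖φ z‖) :
    ∃ d : D, ∀ φ : D →ₐ[ℂ] ℂ, φ z ≠ 0 → φ d * φ z = 1 := by
  have hU : ∀ w : ℂ, ‖w‖ = 1 / 2 → IsUnit (algebraMap ℂ D w - z) := by
    intro w hw
    by_contra h
    obtain ⟨φ, hφ⟩ := exists_char_of_not_isUnit h
    have h1 : w = φ z := by
      rw [map_sub, AlgHom.commutes, sub_eq_zero] at hφ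
      exact hφ
    rcases hz φ with h2 | h2
    · rw [h1, h2] at hw; norm_num at hw
    · rw [← h1, hw] at h2; norm_num at h2
  let R : ℂ → D := fun w => Ring.inverse (algebraMap ℂ D w - z)
  have hR : ∀ w : ℂ, ‖w‖ = 1 / 2 → ∀ φ : D →ₐ[ℂ] ℂ, φ (R w) = (w - φ z)⁻¹ := by
    intro w hw φ
    have := congrArg φ (Ring.mul_inverse_cancel _ (hU w hw))
    rw [map_mul, map_sub, AlgHom.commutes, map_one] at this
    exact eq_inv_of_mul_eq_one_right this
  have hcont : ContinuousOn R (sphere (0 : ℂ) (1 / 2)) := by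
    intro w hw
    have hw' : ‖w‖ = 1 / 2 := by simpa using hw
    obtain ⟨u, hu⟩ := hU w hw'
    have h1 : ContinuousAt Ring.inverse (algebraMap ℂ D w - z) := by
      rw [← hu]; exact NormedRing.inverse_continuousAt u
    have h2 : ContinuousAt (fun w : ℂ => algebraMap ℂ D w - z) w := by
      have := algebraMapCLM ℂ D |>.continuous
      exact (this.sub continuous_const).continuousAt
    exact (ContinuousAt.comp (f := fun w : ℂ => algebraMap ℂ D w - z) h1 h2).continuousWithinAt
  have hint : CircleIntegrable R 0 (1 / 2) := hcont.circleIntegrable (by norm_num)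
  let E : D := ∮ w in C(0, 1 / 2), R w
  have hE : ∀ φ : D →ₐ[ℂ] ℂ, φ E = ∮ w in C(0, 1 / 2), (w - φ z)⁻¹ := by
    intro φ
    let L : D →L[ℂ] ℂ := ⟨φ.toLinearMap, alg_hom_cont φ⟩
    have h1 : L E = ∮ w in C(0, 1 / 2), L (R w) := by
      simp only [E, circleIntegral]
      rw [← ContinuousLinearMap.intervalIntegral_comp_comm]
      · simp
      · exact hint.out
    refine h1.trans ?_
    apply circleIntegral.integral_congr (by norm_num)
    intro w hw
    exact hR w (by simpa using hw) φ
  let e : D := (2 * Real.pi * Complex.I : ℂ)⁻¹ • E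
  have hpi : (2 * Real.pi * Complex.I : ℂ) ≠ 0 := by simp [Real.pi_ne_zero]
  have he0 : ∀ φ : D →ₐ[ℂ] ℂ, φ z = 0 → φ e = 1 := by
    intro φ h
    simp only [e, map_smul, hE, smul_eq_mul]
    rw [circleIntegral.integral_sub_inv_of_mem_ball (by simp [h]), inv_mul_cancel₀ hpi]
  have he1 : ∀ φ : D →ₐ[ℂ] ℂ, φ z ≠ 0 → φ e = 0 := by
    intro φ h
    have h1 : 1 ≤ ‖φ z‖ := (hz φ).resolve_left h
    simp only [e, map_smul, hE, smul_eq_mul]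
    have : (∮ w in C(0, 1 / 2), (w - φ z)⁻¹) = 0 := by
      apply DiffContOnCl.circleIntegral_eq_zero (by norm_num)
      apply DifferentiableOn.diffContOnCl
      intro w hw
      apply DifferentiableAt.differentiableWithinAt
      have hw' : ‖w‖ ≤ 1 / 2 := by
        have := closure_ball_subset_closedBall hw
        simpa using this
      have : w - φ z ≠ 0 := by
        intro h0
        rw [sub_eq_zero] at h0
        rw [h0] at hw'; linarith
      fun_prop (disch := assumption)
    rw [this, mul_zero]
  have hunit : IsUnit (z + e) := by
    by_contra h
    obtain ⟨φ, hφ⟩ := exists_char_of_not_isUnit h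
    rw [map_add] at hφ
    by_cases h0 : φ z = 0
    · rw [h0, he0 φ h0] at hφ; norm_num at hφ
    · rw [he1 φ h0, add_zero] at hφ; exact h0 hφ
  refine ⟨Ring.inverse (z + e), fun φ h => ?_⟩
  have := congrArg φ (Ring.inverse_mul_cancel _ hunit)
  rw [map_mul, map_add, he1 φ h, add_zero, map_one] at this
  exact this

variable {A : Type*} [NonUnitalNormedCommRing A] [NormedSpace ℂ A] [SMulCommClass ℂ A A]
  [IsScalarTower ℂ A A]

/-- embedding into the unitization -/
def ulInr (a : A) : UL A := WithLp.toLp 1 (a : Unitization ℂ A)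

theorem ulInr_add (a b : A) : ulInr (a + b) = ulInr a + ulInr b := by
  apply (WithLp.equiv 1 (Unitization ℂ A)).injective
  exact Unitization.inr_add ℂ a b

theorem ulInr_mul (a b : A) : ulInr (a * b) = ulInr a * ulInr b := by
  apply (WithLp.equiv 1 (Unitization ℂ A)).injective
  exact Unitization.inr_mul ℂ a b

theorem ulInr_smul (c : ℂ) (a : A) : ulInr (c • a) = c • ulInr a := by
  apply (WithLp.equiv 1 (Unitization ℂ A)).injective
  exact Unitization.inr_smul ℂ c a

theorem norm_ulInr (a : A) : ‖ulInr a‖ = ‖a‖ := WithLp.unitization_norm_inr a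

theorem norm_ul_one : ‖(1 : UL A)‖ = 1 := by
  rw [WithLp.unitization_norm_def]
  change ‖(1 : Unitization ℂ A).fst‖ + ‖(1 : Unitization ℂ A).snd‖ = 1
  simp

theorem ul_decomp (u : UL A) :
    u = algebraMap ℂ (UL A) (WithLp.ofLp u).fst + ulInr (WithLp.ofLp u).snd := by
  apply (WithLp.equiv 1 (Unitization ℂ A)).injective
  exact (Unitization.inl_fst_add_inr_snd_eq (WithLp.ofLp u)).symm

theorem continuous_ulInr : Continuous (ulInr : A → UL A) :=
  WithLp.unitization_isometry_inr.continuous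

theorem char_restrict [CompleteSpace A] (φ : UL A →ₐ[ℂ] ℂ) (h : ∃ a : A, φ (ulInr a) ≠ 0) :
    (fun a => φ (ulInr a)) ∈ CharSpace A := by
  refine ⟨fun x y => ?_, fun c x => ?_, fun x y => ?_, fun h0 => ?_, ?_⟩
  · simp only [ulInr_add, map_add]
  · simp only [ulInr_smul, map_smul, smul_eq_mul]
  · simp only [ulInr_mul, map_mul]
  · obtain ⟨a, ha⟩ := h
    exact ha (congrFun h0 a)
  · exact (alg_hom_cont φ).comp continuous_ulInr

theorem char_extend {f : A → ℂ} (hf : f ∈ CharSpace A) :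
    ∃ φ : UL A →ₐ[ℂ] ℂ, ∀ a, φ (ulInr a) = f a := by
  obtain ⟨h1, h2, h3, h4, h5⟩ := hf
  let g : A →ₙₐ[ℂ] ℂ :=
    { toFun := f
      map_smul' := h2
      map_zero' := by simpa using h2 0 0
      map_add' := h1
      map_mul' := h3 }
  refine ⟨(Unitization.lift g).comp (WithLp.unitizationAlgEquiv ℂ).toAlgHom, fun a => ?_⟩
  change Unitization.lift g (a : Unitization ℂ A) = f a
  simp [g]

theorem char_of_one_sub_not_isUnit [CompleteSpace A] {y : A} {u : UL A}
    (h : ¬ IsUnit (1 + u * ulInr y)) : ∃ f ∈ CharSpace A, f y ≠ 0 ∧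
      ∃ φ : UL A →ₐ[ℂ] ℂ, (∀ a, φ (ulInr a) = f a) ∧ φ u * f y = -1 := by
  obtain ⟨φ, hφ⟩ := exists_char_of_not_isUnit h
  rw [map_add, map_mul, map_one] at hφ
  have h0 : φ u * φ (ulInr y) = -1 := by linear_combination hφ
  have h1 : φ (ulInr y) ≠ 0 := by
    intro h1; rw [h1] at h0; norm_num at h0
  exact ⟨_, char_restrict φ ⟨y, h1⟩, h1, φ, fun a => rfl, h0⟩

theorem isQuasiInv_of_char [CompleteSpace A] {y : A} (h : ∀ f ∈ CharSpace A, f y ≠ 1) :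
    IsQuasiInv y := by
  have hu : IsUnit (1 + (-1 : UL A) * ulInr y) := by
    by_contra hu
    obtain ⟨f, hf, -, φ, -, h2⟩ := char_of_one_sub_not_isUnit hu
    apply h f hf
    rw [map_neg, map_one] at h2
    linear_combination -h2
  obtain ⟨v, hv⟩ := hu.exists_right_inv
  have hv' : (1 + (-1 : Unitization ℂ A) * (y : Unitization ℂ A)) * WithLp.ofLp v = 1 :=
    congrArg WithLp.ofLp hv
  generalize WithLp.ofLp v = w at hv'
  have hw1 : w.fst = 1 := by
    have := congrArg (fun t : Unitization ℂ A => t.fst) hv'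
    simpa using this
  have hw2 : w.snd - y - y * w.snd = 0 := by
    have := congrArg (fun t : Unitization ℂ A => t.snd) hv'
    simp [hw1] at this
    rw [← this]; abel
  refine ⟨-w.snd, ?_, ?_⟩
  · rw [mul_neg]
    have : y + -w.snd - -(y * w.snd) = -(w.snd - y - y * w.snd) := by abel
    rw [this, hw2, neg_zero]
  · rw [neg_mul, mul_comm w.snd y]
    have : -w.snd + y - -(y * w.snd) = -(w.snd - y - y * w.snd) := by abel
    rw [this, hw2, neg_zero]

theorem eq_zero_of_char [CompleteSpace A]
    (hss : ∀ x : A, (x : Unitization ℂ A) ∈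
      Ideal.jacobson (⊥ : Ideal (Unitization ℂ A)) → x = 0)
    {x : A} (h : ∀ f ∈ CharSpace A, f x = 0) : x = 0 := by
  apply hss
  rw [Ideal.mem_jacobson_bot]
  intro y
  have hu : IsUnit (1 + (WithLp.toLp 1 y : UL A) * ulInr x) := by
    by_contra hu
    obtain ⟨f, hf, h1, -⟩ := char_of_one_sub_not_isUnit hu
    exact h1 (h f hf)
  have := hu.map (WithLp.unitizationAlgEquiv (𝕜 := ℂ) (A := A) ℂ)
  have h2 : (x : Unitization ℂ A) * y + 1 = 1 + y * (x : Unitization ℂ A) := by ring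
  rw [h2]
  exact this

theorem exists_bounded_char {x y : A} (hxy : y * x = x) (hx : x ≠ 0) :
    ∃ f : A → ℂ, (∀ x y, f (x + y) = f x + f y) ∧ (∀ (c : ℂ) (x : A), f (c • x) = c * f x) ∧
       (∀ x y, f (x * y) = f x * f y) ∧ (∀ a, ‖f a‖ ≤ ‖a‖) ∧ f y = 1 := by
  let ι : UL A → UniformSpace.Completion (UL A) := fun a => a
  have hι : ¬ IsUnit (ι (1 - ulInr y)) := by
    intro hu
    have h1 : ι (1 - ulInr y) * ι (ulInr x) = 0 := by
      rw [← UniformSpace.Completion.coe_mul, sub_mul, one_mul, ← ulInr_mul, hxy, sub_self]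
      exact UniformSpace.Completion.coe_zero
    have h2 : ι (ulInr x) = 0 := by
      rwa [hu.mul_right_eq_zero] at h1
    apply hx
    rw [← norm_eq_zero, ← norm_ulInr, ← UniformSpace.Completion.norm_coe]
    exact norm_eq_zero.2 h2
  obtain ⟨φ, hφ⟩ := exists_char_of_not_isUnit hι
  refine ⟨fun a => φ (ι (ulInr a)), fun a b => ?_, fun c a => ?_, fun a b => ?_, fun a => ?_, ?_⟩
  · simp only [ι, ulInr_add, UniformSpace.Completion.coe_add, map_add]
  · simp only [ι, ulInr_smul, UniformSpace.Completion.coe_smul, map_smul, smul_eq_mul]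
  · simp only [ι, ulInr_mul, UniformSpace.Completion.coe_mul, map_mul]
  · have h1 := AlgHom.norm_apply_le_self_mul_norm_one φ (ι (ulInr a))
    have h2 : ‖(1 : UniformSpace.Completion (UL A))‖ = 1 := by
      rw [← UniformSpace.Completion.coe_one, UniformSpace.Completion.norm_coe, norm_ul_one]
    rw [h2, mul_one] at h1
    simpa only [ι, UniformSpace.Completion.norm_coe, norm_ulInr] using h1
  · simp only [ι, UniformSpace.Completion.coe_sub, map_sub, UniformSpace.Completion.coe_one,
      map_one] at hφ
    exact (sub_eq_zero.1 hφ).symm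

theorem exists_bounded_char' {A : Type*} [i : NonUnitalCommRing A] [im : Module ℂ A]
    [j1 : SMulCommClass ℂ A A] [j2 : IsScalarTower ℂ A A] (p : A → ℝ)
    (hp0 : ∀ x, p x = 0 ↔ x = 0)
    (hadd : ∀ x y, p (x + y) ≤ p x + p y)
    (hsmul : ∀ (c : ℂ) (x : A), p (c • x) = ‖c‖ * p x)
    (hmul : ∀ x y, p (x * y) ≤ p x * p y) {x y : A} (hxy : y * x = x) (hx : x ≠ 0) :
    ∃ f : A → ℂ, (∀ x y, f (x + y) = f x + f y) ∧ (∀ (c : ℂ) (x : A), f (c • x) = c * f x) ∧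
       (∀ x y, f (x * y) = f x * f y) ∧ (∀ a, ‖f a‖ ≤ p a) ∧ f y = 1 := by
  let G : AddGroupNorm A :=
    { toFun := p
      map_zero' := (hp0 0).2 rfl
      add_le' := hadd
      neg' := fun a => by simpa using hsmul (-1) a
      eq_zero_of_map_eq_zero' := fun a h => (hp0 a).1 h }
  let i0 : NonUnitalNormedCommRing A :=
    { G.toNormedAddCommGroup, i with
      norm_mul_le := hmul }
  let i1 : NormedSpace ℂ A :=
    { im with
      norm_smul_le := fun c a => (hsmul c a).le }
  exact @exists_bounded_char A i0 i1 j1 j2 x y hxy hx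

/-- the ideal of elements of `A` vanishing on `W`, inside the unitization -/
def kerIdeal (W : Set (A → ℂ)) (hW : W ⊆ CharSpace A) : Ideal (UL A) where
  carrier := {u | ∃ a : A, u = ulInr a ∧ ∀ f ∈ W, f a = 0}
  add_mem' := by
    rintro _ _ ⟨a, rfl, ha⟩ ⟨b, rfl, hb⟩
    exact ⟨a + b, (ulInr_add a b).symm, fun f hf => by
      rw [(hW hf).1, ha f hf, hb f hf, add_zero]⟩
  zero_mem' := ⟨0, by
    simpa using (ulInr_smul (0 : ℂ) (0 : A)).symm, fun f hf => by simpa using (hW hf).2.1 0 0⟩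
  smul_mem' := by
    rintro c _ ⟨a, rfl, ha⟩
    refine ⟨(WithLp.ofLp c).fst • a + (WithLp.ofLp c).snd * a, ?_, fun f hf => ?_⟩
    · conv_lhs => rw [ul_decomp c]
      rw [smul_eq_mul, add_mul, ulInr_add, ulInr_smul, ulInr_mul, Algebra.smul_def]
    · rw [(hW hf).1, (hW hf).2.1, (hW hf).2.2.1, ha f hf]; ring

theorem kerIdeal_closed (W : Set (A → ℂ)) (hW : W ⊆ CharSpace A) :
    IsClosed (kerIdeal W hW : Set (UL A)) := by
  have : (kerIdeal W hW : Set (UL A)) = {u : UL A | (WithLp.ofLp u).fst = 0} ∩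
      ⋂ f ∈ W, {u : UL A | f (WithLp.ofLp u).snd = 0} := by
    ext u
    simp only [Set.mem_inter_iff, Set.mem_iInter, Set.mem_ofPred_eq]
    constructor
    · rintro ⟨a, rfl, ha⟩
      refine ⟨rfl, ha⟩
    · rintro ⟨h1, h2⟩
      refine ⟨_, ?_, h2⟩
      conv_lhs => rw [ul_decomp u, h1, map_zero, zero_add]
  rw [this]
  have hfs : Continuous fun u : UL A => (WithLp.ofLp u).fst := by
    let L : UL A →ₗ[ℂ] ℂ :=
      { toFun := fun u => (WithLp.ofLp u).fst, map_add' := fun _ _ => rfl,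
        map_smul' := fun _ _ => rfl }
    refine AddMonoidHomClass.continuous_of_bound L 1 fun u => ?_
    rw [one_mul, WithLp.unitization_norm_def]
    exact le_add_of_nonneg_right (norm_nonneg _)
  have hsn : Continuous fun u : UL A => (WithLp.ofLp u).snd := by
    let L : UL A →ₗ[ℂ] A :=
      { toFun := fun u => (WithLp.ofLp u).snd, map_add' := fun _ _ => rfl,
        map_smul' := fun _ _ => rfl }
    refine AddMonoidHomClass.continuous_of_bound L 1 fun u => ?_
    rw [one_mul, WithLp.unitization_norm_def]
    exact le_add_of_nonneg_left (norm_nonneg _)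
  refine (isClosed_eq hfs continuous_const).inter ?_
  refine isClosed_biInter fun f hf => ?_
  exact isClosed_eq ((hW hf).2.2.2.2.comp hsn) continuous_const

theorem exists_local_unit [CompleteSpace A] (hreg : IsRegularAlg A) (z : A) :
    ∃ y : A, (∀ f ∈ CharSpace A, f z = 0 → f y = 0) ∧
      (∀ f ∈ CharSpace A, 1 ≤ ‖f z‖ → f y = 1) := by
  let W : Set (A → ℂ) := {f | f ∈ CharSpace A ∧ 1 ≤ ‖f z‖}
  have hW : W ⊆ CharSpace A := fun f hf => hf.1
  let J := kerIdeal W hW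
  have : IsClosed (J : Set (UL A)) := kerIdeal_closed W hW
  let π : UL A →ₐ[ℂ] (UL A ⧸ J) := Ideal.Quotient.mkₐ ℂ J
  have hclosed : IsClosed {g : ↥(CharSpace A) | (g : A → ℂ) ∈ W} := by
    have : {g : ↥(CharSpace A) | (g : A → ℂ) ∈ W} =
        {g : ↥(CharSpace A) | 1 ≤ ‖(g : A → ℂ) z‖} := by
      ext g
      exact ⟨fun h => h.2, fun h => ⟨g.2, h⟩⟩
    rw [this]
    exact isClosed_le continuous_const
      (((continuous_apply z).comp continuous_subtype_val).norm)
  have : CompleteSpace (UL A ⧸ J) := by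
    exact inferInstanceAs (CompleteSpace (UL A ⧸ J.toAddSubgroup))
  obtain ⟨d, hd⟩ := exists_local_inverse (π (ulInr z)) (by
    intro φ
    by_cases h0 : φ (π (ulInr z)) = 0
    · exact Or.inl h0
    right
    have hf := char_restrict (φ.comp π) ⟨z, h0⟩
    by_contra hlt
    obtain ⟨x, hx, hx1⟩ := hreg W hW hclosed _ hf (fun h => hlt h.2)
    apply hx1
    have : π (ulInr x) = 0 := Ideal.Quotient.eq_zero_iff_mem.2 ⟨x, rfl, hx⟩
    simp [this])
  obtain ⟨u, hu⟩ := Ideal.Quotient.mkₐ_surjective ℂ J d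
  let y : A := (WithLp.ofLp u).fst • z + (WithLp.ofLp u).snd * z
  have hy : ulInr y = u * ulInr z := by
    conv_rhs => rw [ul_decomp u]
    rw [add_mul, ulInr_add, ulInr_smul, ulInr_mul, Algebra.smul_def]
  refine ⟨y, fun f hf h0 => ?_, fun f hf h1 => ?_⟩
  · obtain ⟨φ, hφ⟩ := char_extend hf
    rw [← hφ, hy, map_mul, hφ, h0, mul_zero]
  · obtain ⟨φ, hφ⟩ := char_extend hf
    let ψ : (UL A ⧸ J) →ₐ[ℂ] ℂ := Ideal.Quotient.liftₐ J φ (by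
      rintro _ ⟨a, rfl, ha⟩
      rw [hφ]; exact ha f ⟨hf, h1⟩)
    have hψ : ∀ v, ψ (π v) = φ v := fun v => rfl
    have := hd ψ (by
      rw [hψ, hφ]; intro h0; rw [h0] at h1; norm_num at h1)
    rw [← hu] at this
    change ψ (π u) * _ = 1 at this
    rw [hψ, hψ] at this
    rw [← hφ, hy, map_mul, this]

theorem char_le_norm [CompleteSpace A]
    (hss : ∀ x : A, (x : Unitization ℂ A) ∈
      Ideal.jacobson (⊥ : Ideal (Unitization ℂ A)) → x = 0)
    (hreg : IsRegularAlg A)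
    (p : A → ℝ)
    (hp0 : ∀ x, p x = 0 ↔ x = 0)
    (hadd : ∀ x y, p (x + y) ≤ p x + p y)
    (hsmul : ∀ (c : ℂ) (x : A), p (c • x) = ‖c‖ * p x)
    (hmul : ∀ x y, p (x * y) ≤ p x * p y) :
    ∀ f ∈ CharSpace A, ∀ a, ‖f a‖ ≤ p a := by
  let N : Set (A → ℂ) := {f | f ∈ CharSpace A ∧ ∀ a, ‖f a‖ ≤ p a}
  have hN : N ⊆ CharSpace A := fun f hf => hf.1
  have hNc : IsClosed {g : ↥(CharSpace A) | (g : A → ℂ) ∈ N} := by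
    have : {g : ↥(CharSpace A) | (g : A → ℂ) ∈ N} =
        ⋂ a, {g : ↥(CharSpace A) | ‖(g : A → ℂ) a‖ ≤ p a} := by
      ext g
      simp only [Set.mem_iInter]
      exact ⟨fun h => h.2, fun h => ⟨g.2, h⟩⟩
    rw [this]
    exact isClosed_iInter fun a => isClosed_le
      (((continuous_apply a).comp continuous_subtype_val).norm) continuous_const
  intro f₁ hf₁
  by_contra hcon
  obtain ⟨z₀, hz₀, hz₁⟩ := hreg N hN hNc f₁ hf₁ (fun h => hcon h.2)
  let z : A := (2 * (f₁ z₀)⁻¹) • z₀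
  have hzN : ∀ f ∈ N, f z = 0 := fun f hf => by
    simp only [z]; rw [(hN hf).2.1, hz₀ f hf, mul_zero]
  have hzf : f₁ z = 2 := by
    simp only [z]; rw [hf₁.2.1, mul_assoc, inv_mul_cancel₀ hz₁, mul_one]
  obtain ⟨y, hy0, hy1⟩ := exists_local_unit hreg z
  let F : Set (A → ℂ) := {f | f ∈ CharSpace A ∧ ‖f z‖ ≤ 1}
  have hFc : IsClosed {g : ↥(CharSpace A) | (g : A → ℂ) ∈ F} := by
    have : {g : ↥(CharSpace A) | (g : A → ℂ) ∈ F} =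
        {g : ↥(CharSpace A) | ‖(g : A → ℂ) z‖ ≤ 1} := by
      ext g
      exact ⟨fun h => h.2, fun h => ⟨g.2, h⟩⟩
    rw [this]
    exact isClosed_le (((continuous_apply z).comp continuous_subtype_val).norm) continuous_const
  obtain ⟨x, hx, hx1⟩ := hreg F (fun f hf => hf.1) hFc f₁ hf₁ (fun h => by
    have := h.2; rw [hzf] at this; norm_num at this)
  have hxy : y * x = x := by
    have : y * x + (-1 : ℂ) • x = 0 := eq_zero_of_char hss fun f hf => by
      rw [hf.1, hf.2.2.1, hf.2.1]
      by_cases h : ‖f z‖ ≤ 1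
      · rw [hx f ⟨hf, h⟩]; ring
      · rw [hy1 f hf (not_le.1 h).le]; ring
    rw [neg_smul, one_smul] at this
    exact add_neg_eq_zero.1 this
  have hx0 : x ≠ 0 := by
    rintro rfl
    apply hx1
    simpa using hf₁.2.1 0 0
  obtain ⟨f, h1, h2, h3, h4', h5⟩ := exists_bounded_char' p hp0 hadd hsmul hmul hxy hx0
  -- `f` is a continuous character of the Banach algebra
  let g : A →ₙₐ[ℂ] ℂ :=
    { toFun := f
      map_smul' := h2
      map_zero' := by simpa using h2 0 0
      map_add' := h1
      map_mul' := h3 }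
  let φ : UL A →ₐ[ℂ] ℂ := (Unitization.lift g).comp (WithLp.unitizationAlgEquiv ℂ).toAlgHom
  have hφ : ∀ a, φ (ulInr a) = f a := fun a => by
    change Unitization.lift g (a : Unitization ℂ A) = f a
    simp [g]
  have hfC : f ∈ CharSpace A := by
    have := char_restrict φ ⟨y, by rw [hφ, h5]; exact one_ne_zero⟩
    simpa only [hφ] using this
  have hfN : f ∈ N := ⟨hfC, h4'⟩
  have := hy0 f hfC (hzN f hfN)
  rw [h5] at this
  exact one_ne_zero this

end AlgNormAux

/-- Let `A` be a regular semisimple commutative complex Banach algebra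
(semisimple: the Jacobson radical, computed via the unitization, is zero).
Then every algebra norm `p` on `A` is a Q-algebra norm: the set of
quasi-invertible elements is open in the topology of `p`. -/
theorem algebra_norm_is_qAlgebra_norm {A : Type*} [NonUnitalNormedCommRing A]
    [NormedSpace ℂ A] [SMulCommClass ℂ A A] [IsScalarTower ℂ A A] [CompleteSpace A]
    (hss : ∀ x : A, (x : Unitization ℂ A) ∈
      Ideal.jacobson (⊥ : Ideal (Unitization ℂ A)) → x = 0)
    (hreg : IsRegularAlg A)
    (p : A → ℝ)
    (hp0 : ∀ x, p x = 0 ↔ x = 0)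
    (hadd : ∀ x y, p (x + y) ≤ p x + p y)
    (hsmul : ∀ (c : ℂ) (x : A), p (c • x) = ‖c‖ * p x)
    (hmul : ∀ x y, p (x * y) ≤ p x * p y) :
    NormOpen p {x : A | IsQuasiInv x} := by

  have hle := char_le_norm hss hreg p hp0 hadd hsmul hmul
  have hpn : ∀ a, 0 ≤ p a := fun a => by
    have h1 := hadd a ((-1 : ℂ) • a)
    rw [hsmul, neg_smul, one_smul, add_neg_cancel, (hp0 0).2 rfl] at h1
    simp only [norm_neg, norm_one, one_mul] at h1
    linarith
  rintro x ⟨x', hx1, -⟩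
  have hpos : 0 < 1 + p x' := by linarith [hpn x']
  refine ⟨(1 + p x')⁻¹, inv_pos.2 hpos, fun y hy => ?_⟩
  apply isQuasiInv_of_char
  intro f hf hfy
  have e1 : f x + f x' - f x * f x' = 0 := by
    have h0 : f 0 = 0 := by simpa using hf.2.1 0 0
    have h := congrArg f hx1
    have h2 : x + x' - x * x' = x + x' + (-1 : ℂ) • (x * x') := by
      rw [neg_smul, one_smul, sub_eq_add_neg]
    rw [h2, hf.1, hf.1, hf.2.1, hf.2.2.1, h0] at h
    linear_combination h
  have e2 : f (y - x) = f y - f x := by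
    have h2 : y - x = y + (-1 : ℂ) • x := by
      rw [neg_smul, one_smul, sub_eq_add_neg]
    rw [h2, hf.1, hf.2.1]; ring
  have e3 : f (y - x) * (1 - f x') = 1 := by
    rw [e2, hfy]; linear_combination -e1
  have e4 : ‖f (y - x)‖ * ‖1 - f x'‖ = 1 := by rw [← norm_mul, e3, norm_one]
  have e5 : ‖1 - f x'‖ ≤ 1 + p x' := by
    refine (norm_sub_le _ _).trans ?_
    rw [norm_one]; linarith [hle f hf x']
  have e6 : ‖f (y - x)‖ ≤ p (y - x) := hle f hf _
  have e7 : p (y - x) * (1 + p x') < 1 := by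
    rwa [← lt_div_iff₀ hpos, one_div]
  have e8 : ‖f (y - x)‖ * ‖1 - f x'‖ ≤ p (y - x) * (1 + p x') :=
    mul_le_mul e6 e5 (norm_nonneg _) (hpn _)
  linarith
end

section
/- Let (A,‖·‖) be a commutative complex Banach algebra which is semisimple (Jacobson radical {0}) and regular. Then for every algebra norm p on A, the spectral radius satisfies r_A(x) ≤ p(x) for all x ∈ A. -/
open UniformSpace

noncomputable section SpecAux

/-- The `L¹` unitization. -/
abbrev UU (P : Type*) [NonUnitalNormedCommRing P] [NormedSpace ℂ P] : Type _ :=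
  WithLp 1 (Unitization ℂ P)

instance UU.instNormedCommRing {P : Type*} [NonUnitalNormedCommRing P] [NormedSpace ℂ P]
    [SMulCommClass ℂ P P] [IsScalarTower ℂ P P] : NormedCommRing (UU P) :=
  { WithLp.instUnitizationNormedRing with
    mul_comm := fun x y => by
      apply (WithLp.equiv 1 (Unitization ℂ P)).injective
      exact mul_comm (WithLp.ofLp x) (WithLp.ofLp y) }

instance UU.instNormedAlgebra {P : Type*} [NonUnitalNormedCommRing P] [NormedSpace ℂ P]
    [SMulCommClass ℂ P P] [IsScalarTower ℂ P P] :
    NormedAlgebra ℂ (UU P) :=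
  { (inferInstance : Algebra ℂ (WithLp 1 (Unitization ℂ P))) with
    norm_smul_le := fun r x => norm_smul_le r x }

section
variable {P : Type*} [NonUnitalNormedCommRing P] [NormedSpace ℂ P]
    [SMulCommClass ℂ P P] [IsScalarTower ℂ P P]

/-- the inclusion -/
def uinr (a : P) : UU P := WithLp.toLp 1 (a : Unitization ℂ P)

lemma uinr_add (a b : P) : uinr (a + b) = uinr a + uinr b := by
  apply (WithLp.equiv 1 (Unitization ℂ P)).injective
  exact Unitization.inr_add ℂ a b

lemma uinr_mul (a b : P) : uinr (a * b) = uinr a * uinr b := by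
  apply (WithLp.equiv 1 (Unitization ℂ P)).injective
  exact Unitization.inr_mul ℂ a b

lemma uinr_smul (c : ℂ) (b : P) : uinr (c • b) = c • uinr b := by
  apply (WithLp.equiv 1 (Unitization ℂ P)).injective
  exact Unitization.inr_smul ℂ c b

lemma norm_uinr (a : P) : ‖uinr a‖ = ‖a‖ := WithLp.unitization_norm_inr a

lemma norm_one_UU : ‖(1 : UU P)‖ = 1 := by
  have h := WithLp.unitization_norm_def (𝕜 := ℂ) (A := P) (1 : UU P)
  refine h.trans ?_
  change ‖(1 : Unitization ℂ P).fst‖ + ‖(1 : Unitization ℂ P).snd‖ = 1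
  simp

lemma mul_uinr (u : UU P) (a : P) : ∃ b : P, u * uinr a = uinr b := by
  refine ⟨(WithLp.ofLp u).fst • a + (WithLp.ofLp u).snd * a, ?_⟩
  apply (WithLp.equiv 1 (Unitization ℂ P)).injective
  change WithLp.ofLp u * (a : Unitization ℂ P) = _
  change _ = (((WithLp.ofLp u).fst • a + (WithLp.ofLp u).snd * a : P) : Unitization ℂ P)
  ext <;> simp

lemma uinr_inj {a b : P} (h : uinr a = uinr b) : a = b := by
  have := congrArg WithLp.ofLp h
  exact Unitization.inr_injective this

lemma isUnit_UU_iff (u : UU P) : IsUnit u ↔ IsUnit (WithLp.ofLp u) :=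
  (MulEquiv.isUnit_map (WithLp.unitizationAlgEquiv (𝕜 := ℂ) (A := P) ℂ)).symm

/-- restriction of a character -/
def urestr (φ : UU P →ₐ[ℂ] ℂ) : P → ℂ := fun a => φ (uinr a)

lemma uextend (f : P → ℂ) (h1 : ∀ x y, f (x + y) = f x + f y)
    (h2 : ∀ (c : ℂ) (x : P), f (c • x) = c * f x) (h3 : ∀ x y, f (x * y) = f x * f y) :
    ∃ φ : UU P →ₐ[ℂ] ℂ, ∀ a, φ (uinr a) = f a := by
  let g : P →ₙₐ[ℂ] ℂ :=
    { toFun := f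
      map_smul' := h2
      map_zero' := by simpa using h2 0 0
      map_add' := h1
      map_mul' := h3 }
  refine ⟨(Unitization.lift g).comp
    (WithLp.unitizationAlgEquiv (𝕜 := ℂ) (A := P) ℂ).toAlgHom, fun a => ?_⟩
  change Unitization.lift g (a : Unitization ℂ P) = f a
  simp [g]

lemma exists_char {C : Type*} [NormedCommRing C] [NormedAlgebra ℂ C] [CompleteSpace C]
    {u : C} (hu : ¬ IsUnit u) : ∃ φ : C →ₐ[ℂ] ℂ, φ u = 0 := by
  obtain ⟨f, hf⟩ := WeakDual.CharacterSpace.exists_apply_eq_zero hu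
  exact ⟨WeakDual.CharacterSpace.equivAlgHom f, hf⟩

lemma eq_zero_of_p (b y : P) (hby : b * y = y)
    (hb : ∀ f : P → ℂ, (∀ x y, f (x + y) = f x + f y) →
      (∀ (c : ℂ) (x : P), f (c • x) = c * f x) → (∀ x y, f (x * y) = f x * f y) →
      (∀ x, ‖f x‖ ≤ ‖x‖) → f b = 0) : y = 0 := by
  let B := Completion (UU P)
  let j : UU P →+* B := Completion.coeRingHom
  have hj : ∀ u : UU P, ‖j u‖ = ‖u‖ := fun u => Completion.norm_coe u
  have hjs : ∀ (c : ℂ) (u : UU P), j (c • u) = c • j u := fun c u => Completion.coe_smul c u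
  have hunit : IsUnit (1 - j (uinr b)) := by
    by_contra hn
    obtain ⟨φ, hφ⟩ := exists_char hn
    have h0 := hb (fun a => φ (j (uinr a))) (fun x y => by simp [uinr_add])
      (fun c x => by simp [uinr_smul, hjs]) (fun x y => by simp [uinr_mul])
      (fun x => by
        have := AlgHom.norm_apply_le_self_mul_norm_one φ (j (uinr x))
        have h1 : ‖(1 : B)‖ = 1 := by rw [← map_one j, hj, norm_one_UU]
        rwa [h1, mul_one, hj, norm_uinr] at this)
    simp only [map_sub, map_one] at hφ
    rw [h0] at hφ
    simp at hφ
  have hz : (1 - j (uinr b)) * j (uinr y) = 0 := by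
    rw [sub_mul, one_mul, ← map_mul, ← uinr_mul, hby, sub_self]
  have : j (uinr y) = 0 := (hunit.mul_right_eq_zero).1 hz
  have h2 := hj (uinr y)
  rw [this, norm_zero, norm_uinr] at h2
  exact norm_eq_zero.1 h2.symm

end

lemma eq_zero_of_p' {P : Type*} [I : NonUnitalCommRing P] [Module ℂ P]
    [SMulCommClass ℂ P P] [IsScalarTower ℂ P P] (p : P → ℝ)
    (hp0 : ∀ x, p x = 0 ↔ x = 0)
    (hadd : ∀ x y, p (x + y) ≤ p x + p y)
    (hsmul : ∀ (c : ℂ) (x : P), p (c • x) = ‖c‖ * p x)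
    (hmul : ∀ x y, p (x * y) ≤ p x * p y) (b y : P) (hby : b * y = y)
    (hb : ∀ f : P → ℂ, (∀ x y, f (x + y) = f x + f y) →
      (∀ (c : ℂ) (x : P), f (c • x) = c * f x) → (∀ x y, f (x * y) = f x * f y) →
      (∀ x, ‖f x‖ ≤ p x) → f b = 0) : y = 0 := by
  let N : AddGroupNorm P :=
    { toFun := p
      map_zero' := (hp0 0).2 rfl
      add_le' := hadd
      neg' := fun x => by simpa using hsmul (-1) x
      eq_zero_of_map_eq_zero' := fun x => (hp0 x).1 }
  letI G : NormedAddCommGroup P := N.toNormedAddCommGroup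
  letI R : NonUnitalNormedCommRing P :=
    { G, I with norm_mul_le := hmul }
  letI S : NormedSpace ℂ P :=
    { norm_smul_le := fun c x => (hsmul c x).le }
  exact eq_zero_of_p b y hby hb

lemma contour {C : Type*} [NormedCommRing C] [NormedAlgebra ℂ C] [CompleteSpace C]
    (x : C) (hx : ∀ φ : C →ₐ[ℂ] ℂ, φ x = 0 ∨ ‖φ x - 1‖ ≤ 1 / 2) :
    ∃ w : C, ∀ φ : C →ₐ[ℂ] ℂ, φ x ≠ 0 → φ w * φ x = 1 := by
  have hres : ∀ z ∈ Metric.sphere (1 : ℂ) (3 / 4), IsUnit (algebraMap ℂ C z - x) := by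
    intro z hz
    by_contra hn
    obtain ⟨φ, hφ⟩ := exists_char hn
    simp only [map_sub, AlgHomClass.commutes, sub_eq_zero] at hφ
    have hz' : ‖z - 1‖ = 3 / 4 := by simpa [dist_eq_norm] using hz
    have hφ' : z = φ x := hφ
    rcases hx φ with h | h
    · rw [hφ', h] at hz'
      norm_num at hz'
    · rw [hφ'] at hz'
      linarith
  have hz0 : ∀ z ∈ Metric.sphere (1 : ℂ) (3 / 4), z ≠ 0 := by
    rintro z hz rfl
    norm_num at hz
  let F : ℂ → C := fun z => z⁻¹ • Ring.inverse (algebraMap ℂ C z - x)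
  have hF : ContinuousOn F (Metric.sphere (1 : ℂ) (3 / 4)) := by
    intro z hz
    apply ContinuousAt.continuousWithinAt
    apply ContinuousAt.smul (continuousAt_inv₀ (hz0 z hz))
    obtain ⟨u, hu⟩ := hres z hz
    have h1 := NormedRing.inverse_continuousAt u
    rw [hu] at h1
    exact ContinuousAt.comp (f := fun z : ℂ => algebraMap ℂ C z - x) h1
      (((continuous_algebraMap ℂ C).sub continuous_const).continuousAt)
  have hFi : CircleIntegrable F 1 (3 / 4) := hF.circleIntegrable (by norm_num)
  refine ⟨(2 * Real.pi * Complex.I : ℂ)⁻¹ • ∮ z in C(1, 3 / 4), F z, fun φ h0 => ?_⟩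
  have hball : φ x ∈ Metric.ball (1 : ℂ) (3 / 4) := by
    rw [mem_ball_iff_norm]
    rcases hx φ with h | h
    · exact absurd h h0
    · linarith
  have hcomm : φ (∮ z in C(1, 3 / 4), F z) = ∮ z in C(1, 3 / 4), φ (F z) := by
    have hh := φ.toContinuousLinearMap.intervalIntegral_comp_comm (𝕜 := ℂ) hFi.out
    simp only [AlgHom.coe_toContinuousLinearMap] at hh
    unfold circleIntegral
    rw [← hh]
    simp
  have hval : (∮ z in C(1, 3 / 4), φ (F z)) = ∮ z in C(1, 3 / 4), (z - φ x)⁻¹ • z⁻¹ := by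
    apply circleIntegral.integral_congr (by norm_num)
    intro z hz
    obtain ⟨u, hu⟩ := hres z hz
    have e : φ (Ring.inverse (algebraMap ℂ C z - x)) * (z - φ x) = 1 := by
      have : φ (algebraMap ℂ C z - x) = z - φ x := by simp
      rw [← this, ← map_mul, Ring.inverse_mul_cancel _ (hres z hz), map_one]
    have e2 := eq_inv_of_mul_eq_one_left e
    simp only [F, map_smul, e2, smul_eq_mul]
    ring
  have hC : (∮ z in C(1, 3 / 4), (z - φ x)⁻¹ • z⁻¹) = (2 * Real.pi * Complex.I : ℂ) • (φ x)⁻¹ := by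
    apply DiffContOnCl.circleIntegral_sub_inv_smul (f := fun z : ℂ => z⁻¹) _ hball
    apply DifferentiableOn.diffContOnCl
    intro z hz
    have hz := Metric.closure_ball_subset_closedBall hz
    apply DifferentiableAt.differentiableWithinAt
    apply differentiableAt_inv
    rintro rfl
    norm_num at hz
  rw [map_smul, hcomm, hval, hC, smul_smul, inv_mul_cancel₀ Complex.two_pi_I_ne_zero, one_smul,
    inv_mul_cancel₀ h0]

lemma exists_quot_inv {U : Type*} [NormedCommRing U] [NormedAlgebra ℂ U] [CompleteSpace U]
    (x y : U) (hx : ∀ φ : U →ₐ[ℂ] ℂ, (∀ k, k * y = 0 → φ k = 0) → φ x = 0 ∨ ‖φ x - 1‖ ≤ 1 / 2) :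
    ∃ w : U, ∀ φ : U →ₐ[ℂ] ℂ, (∀ k, k * y = 0 → φ k = 0) → φ x ≠ 0 → φ w * φ x = 1 := by
  let K : Ideal U :=
    { carrier := {k | k * y = 0}
      add_mem' := fun {a b} ha hb => by
        simp only [Set.mem_setOf_eq] at *
        rw [add_mul, ha, hb, add_zero]
      zero_mem' := by simp
      smul_mem' := fun c a ha => by
        simp only [Set.mem_setOf_eq, smul_eq_mul] at *
        rw [mul_assoc, ha, mul_zero] }
  haveI hK : IsClosed (K : Set U) := by
    change IsClosed {k : U | k * y = 0}
    exact isClosed_eq (by fun_prop) continuous_const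
  have hmem : ∀ k, k ∈ K ↔ k * y = 0 := fun k => Iff.rfl
  obtain ⟨w, hw⟩ := contour (C := U ⧸ K) (Ideal.Quotient.mkₐ ℂ K x) (fun φ => by
    refine hx (φ.comp (Ideal.Quotient.mkₐ ℂ K)) fun k hk => ?_
    have : Ideal.Quotient.mkₐ ℂ K k = 0 := Ideal.Quotient.eq_zero_iff_mem.2 ((hmem k).2 hk)
    rw [AlgHom.comp_apply, this, map_zero])
  obtain ⟨w, rfl⟩ := Ideal.Quotient.mkₐ_surjective ℂ K w
  refine ⟨w, fun φ hφ h0 => ?_⟩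
  exact hw (Ideal.Quotient.liftₐ K φ (fun a ha => hφ a ((hmem a).1 ha))) h0

section
variable {A : Type*} [NonUnitalNormedCommRing A]
    [NormedSpace ℂ A] [SMulCommClass ℂ A A] [IsScalarTower ℂ A A] [CompleteSpace A]

lemma restr_mem (φ : UU A →ₐ[ℂ] ℂ) (a : A) (h : φ (uinr a) ≠ 0) :
    (fun a => φ (uinr a)) ∈ CharSpace A := by
  refine ⟨fun x y => by simp [uinr_add], fun c x => by simp [uinr_smul],
    fun x y => by simp [uinr_mul], fun h0 => h (congrFun h0 a), ?_⟩
  exact (map_continuous φ).comp WithLp.unitization_isometry_inr.continuous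

lemma eq_zero_of_chars (hss : ∀ x : A, (x : Unitization ℂ A) ∈
      Ideal.jacobson (⊥ : Ideal (Unitization ℂ A)) → x = 0)
    (a : A) (ha : ∀ f ∈ CharSpace A, f a = 0) : a = 0 := by
  apply hss
  rw [Ideal.mem_jacobson_bot]
  intro v
  have key : IsUnit (uinr a * WithLp.toLp 1 v + 1 : UU A) := by
    by_contra hn
    obtain ⟨φ, hφ⟩ := exists_char hn
    have h0 : φ (uinr a) = 0 := by
      by_contra h
      exact h (ha _ (restr_mem φ a h))
    rw [map_add, map_mul, h0, zero_mul, map_one, zero_add] at hφ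
    exact one_ne_zero hφ
  exact (isUnit_UU_iff _).1 key

lemma char_le (hss : ∀ x : A, (x : Unitization ℂ A) ∈
      Ideal.jacobson (⊥ : Ideal (Unitization ℂ A)) → x = 0)
    (hreg : IsRegularAlg A)
    (p : A → ℝ)
    (hp0 : ∀ x, p x = 0 ↔ x = 0)
    (hadd : ∀ x y, p (x + y) ≤ p x + p y)
    (hsmul : ∀ (c : ℂ) (x : A), p (c • x) = ‖c‖ * p x)
    (hmul : ∀ x y, p (x * y) ≤ p x * p y) (f₁ : A → ℂ) (hf₁ : f₁ ∈ CharSpace A) :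
    ∀ a, ‖f₁ a‖ ≤ p a := by
  by_contra hcon
  have hev : ∀ a : A, Continuous fun g : CharSpace A => (g : A → ℂ) a :=
    fun a => (continuous_apply a).comp continuous_subtype_val
  obtain ⟨x₀, hx₀, hx₀1⟩ := hreg {f | f ∈ CharSpace A ∧ ∀ a, ‖f a‖ ≤ p a} (fun f hf => hf.1)
    (by
      have : {g : CharSpace A | (g : A → ℂ) ∈ {f | f ∈ CharSpace A ∧ ∀ a, ‖f a‖ ≤ p a}}
          = ⋂ a, {g : CharSpace A | ‖(g : A → ℂ) a‖ ≤ p a} := by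
        ext g
        simp
      rw [this]
      exact isClosed_iInter fun a => isClosed_le (hev a).norm continuous_const)
    f₁ hf₁ (fun h => hcon h.2)
  -- normalise
  obtain ⟨x, hx, hx1⟩ : ∃ x : A, (∀ f ∈ CharSpace A, (∀ a, ‖f a‖ ≤ p a) → f x = 0) ∧ f₁ x = 1 := by
    refine ⟨(f₁ x₀)⁻¹ • x₀, fun f hf hfp => ?_, ?_⟩
    · rw [hf.2.1, hx₀ f ⟨hf, hfp⟩, mul_zero]
    · rw [hf₁.2.1, inv_mul_cancel₀ hx₀1]
  obtain ⟨y, hy, hy1⟩ := hreg {f | f ∈ CharSpace A ∧ 1 / 2 ≤ ‖f x - 1‖} (fun f hf => hf.1)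
    (by
      have : {g : CharSpace A | (g : A → ℂ) ∈ {f | f ∈ CharSpace A ∧ 1 / 2 ≤ ‖f x - 1‖}}
          = {g : CharSpace A | 1 / 2 ≤ ‖(g : A → ℂ) x - 1‖} := by
        ext g
        simp
      rw [this]
      exact isClosed_le continuous_const ((hev x).sub continuous_const).norm)
    f₁ hf₁ (fun h => by
      have := h.2
      rw [hx1] at this
      norm_num at this)
  have hyne : y ≠ 0 := by
    rintro rfl
    apply hy1
    simpa using hf₁.2.1 0 0
  obtain ⟨w, hw⟩ := exists_quot_inv (uinr x) (uinr y) (fun φ hφ => by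
    by_contra! hc
    obtain ⟨hc0, hc1⟩ := hc
    obtain ⟨a, ha, ha1⟩ := hreg {f | f ∈ CharSpace A ∧ ‖f x - 1‖ ≤ 1 / 2} (fun f hf => hf.1)
      (by
        have : {g : CharSpace A | (g : A → ℂ) ∈ {f | f ∈ CharSpace A ∧ ‖f x - 1‖ ≤ 1 / 2}}
            = {g : CharSpace A | ‖(g : A → ℂ) x - 1‖ ≤ 1 / 2} := by
          ext g
          simp
        rw [this]
        exact isClosed_le ((hev x).sub continuous_const).norm continuous_const)
      _ (restr_mem φ x hc0) (fun h => absurd h.2 (not_le.2 hc1))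
    apply ha1
    apply hφ
    have : a * y = 0 := by
      apply eq_zero_of_chars hss
      intro f hf
      rw [hf.2.2.1]
      rcases le_total ‖f x - 1‖ (1 / 2) with h | h
      · rw [ha f ⟨hf, h⟩, zero_mul]
      · rw [hy f ⟨hf, h⟩, mul_zero]
    rw [← uinr_mul, this]
    rfl)
  obtain ⟨b, hb⟩ := mul_uinr w x
  have hby : b * y = y := by
    rw [← sub_eq_zero]
    apply eq_zero_of_chars hss
    intro f hf
    obtain ⟨φ, hφ⟩ := uextend f hf.1 hf.2.1 hf.2.2.1
    rw [← hφ]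
    have e : uinr (b * y - y) = (w * uinr x - 1) * uinr y := by
      have h1 : uinr (b * y - y) + uinr y = uinr (b * y) := by rw [← uinr_add, sub_add_cancel]
      rw [hb, sub_mul, one_mul, ← uinr_mul, ← h1, add_sub_cancel_right]
    rw [e, map_mul, map_sub, map_mul, map_one]
    by_cases h0 : φ (uinr y) = 0
    · rw [h0, mul_zero]
    · have hx0 : φ (uinr x) ≠ 0 := by
        intro h
        apply h0
        rw [hφ]
        apply hy
        refine ⟨hf, ?_⟩
        rw [← hφ, h]
        norm_num
      rw [hw φ (fun k hk => ?_) hx0, sub_self, zero_mul]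
      have := congrArg φ hk
      rw [map_mul, map_zero] at this
      exact (mul_eq_zero.1 this).resolve_right h0
  apply hyne
  refine eq_zero_of_p' p hp0 hadd hsmul hmul b y hby ?_
  intro f h1 h2 h3 h4
  by_contra hfb
  obtain ⟨φ, hφ⟩ := uextend f h1 h2 h3
  have hfe : f = fun a => φ (uinr a) := by
    ext a
    exact (hφ a).symm
  have hmem : f ∈ CharSpace A := by
    rw [hfe]
    exact restr_mem φ b (by rw [hφ]; exact hfb)
  apply hfb
  rw [← hφ, ← hb, map_mul, hφ x, hx f hmem h4, mul_zero]

end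

end SpecAux

/-- Let `A` be a regular semisimple commutative complex Banach algebra
(semisimple: the Jacobson radical, computed via the unitization, is zero).
Then for every algebra norm `p` on `A` the spectral radius satisfies
`r_A x ≤ p x` for all `x`, i.e. `‖λ‖ ≤ p x` for every `λ` in the spectrum of `x`
(computed in the unitization). -/
theorem spectralRadius_le_algebra_norm {A : Type*} [NonUnitalNormedCommRing A]
    [NormedSpace ℂ A] [SMulCommClass ℂ A A] [IsScalarTower ℂ A A] [CompleteSpace A]
    (hss : ∀ x : A, (x : Unitization ℂ A) ∈
      Ideal.jacobson (⊥ : Ideal (Unitization ℂ A)) → x = 0)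
    (hreg : IsRegularAlg A)
    (p : A → ℝ)
    (hp0 : ∀ x, p x = 0 ↔ x = 0)
    (hadd : ∀ x y, p (x + y) ≤ p x + p y)
    (hsmul : ∀ (c : ℂ) (x : A), p (c • x) = ‖c‖ * p x)
    (hmul : ∀ x y, p (x * y) ≤ p x * p y) :
    ∀ x : A, ∀ lam ∈ quasispectrum ℂ x, ‖lam‖ ≤ p x := by
  intro x lam hlam
  have hpos : ∀ x, 0 ≤ p x := fun x => by
    have h := hadd x ((-1 : ℂ) • x)
    rw [hsmul, show x + (-1 : ℂ) • x = 0 by simp, (hp0 0).2 rfl] at h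
    simp at h
    linarith
  by_cases h0 : lam = 0
  · rw [h0, norm_zero]
    exact hpos x
  rw [Unitization.quasispectrum_eq_spectrum_inr, spectrum.mem_iff] at hlam
  have hn : ¬ IsUnit (algebraMap ℂ (UU A) lam - uinr x) := fun h =>
    hlam ((isUnit_UU_iff _).1 h)
  obtain ⟨φ, hφ⟩ := exists_char hn
  rw [map_sub, AlgHomClass.commutes, sub_eq_zero] at hφ
  have hφ' : lam = φ (uinr x) := hφ
  rw [hφ']
  exact char_le hss hreg p hp0 hadd hsmul hmul _ (restr_mem φ x (hφ' ▸ h0)) x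
end
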